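/- Let Δ be a euclidean simplex, cΔ = Δ∗[v] its cone, and R a commutative ring with unity. In N_*(cΔ) the following cap product formulas hold: (a) if F is a nonempty face of Δ and G is the face of Δ with 1_F ∪ 1_G = 1_Δ, then 1_{(F,0)} ∩ [cΔ] = (G,1); (b) 1_{(Δ,1)} ∩ [cΔ] = [v]; (c) 1_{(F,1)} ∩ [cΔ] = 0 for every proper face F of Δ; (d) for the empty simplex, 1_{(∅,1)} ∩ [c∅] = [v]. -/

import Mathlib

/-!
Statement 6: cap product formulas in the simplicial chains of a cone `cΔ = Δ ∗ [v]`.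

We model a euclidean simplex with `k` vertices by the linearly ordered vertex set
`Fin k`; its (nonempty) faces are the nonempty finite subsets of `Fin k`, and `N_*(Δ)`,
`N^*(Δ)` are the free `R`-modules on the faces.  On `Δ = [e_0, …, e_m]` the classical
cap product with the top-dimensional face is `1_F ∩ [Δ] = [e_r, …, e_m]` if
`F = [e_0, …, e_r]` and `0` otherwise; in terms of subsets: `1_F ∩ [Δ]` is the basis
chain on `Finset.Ici (max F)` if `F = Finset.Iic (max F)`, and `0` otherwise.
The classical simplicial cup product of indicator cochains is
`1_F ∪ 1_G = 1_{F ∪ G}` if `max F = min G`, and `0` otherwise.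

The cone `cΔ` on the simplex with vertex set `Fin k` is the simplex with vertex set
`Fin (k+1)`, the cone vertex `v = Fin.last k` being the largest one; a face `F` of `Δ`
yields the faces `(F, 0) = F` and `(F, 1) = cF = F ∪ {v}` of `cΔ`, with `(∅, 1) = [v]`.
-/

open Finset

variable (R : Type*) [CommRing R]

/-- The classical simplicial cap product with the top-dimensional face `[Δ]` of the
simplex with vertex set `Fin k`, evaluated on the indicator cochain `1_F`:
`1_F ∩ [Δ] = [e_r, …, e_m]` if `F = [e_0, …, e_r]`, and `0` otherwise. -/
noncomputable def capTop {k : ℕ} (F : Finset (Fin k)) : Finset (Fin k) →₀ R :=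
  if h : F.Nonempty then
    if F = Finset.Iic (F.max' h) then Finsupp.single (Finset.Ici (F.max' h)) (1 : R)
    else 0
  else 0

/-- The classical simplicial cup product of the indicator cochains `1_F` and `1_G`:
`1_F ∪ 1_G = 1_{F ∪ G}` if the last vertex of `F` equals the first vertex of `G`,
and `0` otherwise. -/
noncomputable def cupInd {k : ℕ} (F G : Finset (Fin k)) : Finset (Fin k) →₀ R :=
  if hF : F.Nonempty then
    if hG : G.Nonempty then
      if F.max' hF = G.min' hG then Finsupp.single (F ∪ G) (1 : R) else 0
    else 0
  else 0

/-- The face `(F, ε)` of the cone `cΔ` determined by a face (or the empty subset) `F`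
of `Δ`: `(F, false) = F` and `(F, true) = cF = F ∪ {v}`, where the cone vertex is
`v = Fin.last k`. -/
def coneFace {k : ℕ} (F : Finset (Fin k)) (ε : Bool) : Finset (Fin (k + 1)) :=
  if ε then insert (Fin.last k) (F.map Fin.castSuccEmb) else F.map Fin.castSuccEmb

theorem coneFace_false {k : ℕ} (F : Finset (Fin k)) :
    coneFace F false = F.map Fin.castSuccEmb := rfl

theorem coneFace_true {k : ℕ} (F : Finset (Fin k)) :
    coneFace F true = insert (Fin.last k) (F.map Fin.castSuccEmb) := rfl

theorem coneFace_Iic_false {k : ℕ} (a : Fin k) :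
    coneFace (Finset.Iic a) false = Finset.Iic a.castSucc := by
  ext x
  induction x using Fin.lastCases <;> simp [coneFace_false]

theorem coneFace_Ici_true {k : ℕ} (a : Fin k) :
    coneFace (Finset.Ici a) true = Finset.Ici a.castSucc := by
  ext x
  induction x using Fin.lastCases <;> simp [coneFace_true, Fin.le_last]

theorem coneFace_true_eq_univ_iff {k : ℕ} {F : Finset (Fin k)} :
    coneFace F true = Finset.univ ↔ F = Finset.univ := by
  simp [coneFace_true, Finset.eq_univ_iff_forall, Fin.forall_fin_succ']

theorem capTop_Iic {k : ℕ} (a : Fin k) :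
    capTop R (Finset.Iic a) = Finsupp.single (Finset.Ici a) 1 := by
  have h : (Finset.Iic a).Nonempty := ⟨a, by simp⟩
  have hmax : (Finset.Iic a).max' h = a :=
    le_antisymm (by simp) (Finset.le_max' _ _ (by simp))
  simp [capTop, h, hmax]

theorem capTop_univ (k : ℕ) :
    capTop R (Finset.univ : Finset (Fin (k + 1))) = Finsupp.single {Fin.last k} 1 := by
  have hIic : Finset.Iic (Fin.last k) = Finset.univ := by
    ext x
    simp [Fin.le_last]
  have hIci : Finset.Ici (Fin.last k) = {Fin.last k} := by
    ext x
    simp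
  rw [← hIic, capTop_Iic, hIci]

theorem capTop_eq_zero_of_last_mem {k : ℕ} {F : Finset (Fin (k + 1))}
    (hlast : Fin.last k ∈ F) (hF : F ≠ Finset.univ) : capTop R F = 0 := by
  have h : F.Nonempty := ⟨_, hlast⟩
  have hmax : F.max' h = Fin.last k := le_antisymm (Fin.le_last _) (F.le_max' _ hlast)
  rw [capTop, dif_pos h, if_neg]
  rw [hmax]
  intro hF'
  exact hF (Finset.eq_univ_of_forall fun x => hF' ▸ Finset.mem_Iic.2 (Fin.le_last x))

/-- Over a nontrivial ring, `1_F ∪ 1_G = 1_Δ` forces `F` to be a front face and `G` the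
complementary back face sharing exactly one vertex with it. -/
theorem exists_eq_Iic_Ici_of_cupInd_eq [Nontrivial R] {k : ℕ} {F G : Finset (Fin k)}
    (h : cupInd R F G = Finsupp.single Finset.univ 1) :
    ∃ a, F = Finset.Iic a ∧ G = Finset.Ici a := by
  have hne : (Finsupp.single (Finset.univ : Finset (Fin k)) (1 : R)) ≠ 0 := by simp
  unfold cupInd at h
  split_ifs at h with hF hG hmeet
  · have hcover : ∀ x, x ∈ F ∨ x ∈ G := by
      have hunion : F ∪ G = Finset.univ := (Finsupp.single_left_inj one_ne_zero).1 h
      intro x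
      simpa using Finset.ext_iff.1 hunion x
    refine ⟨F.max' hF, ?_, ?_⟩
    · ext x
      rw [Finset.mem_Iic]
      refine ⟨F.le_max' x, fun hx => (hcover x).elim id fun hxG => ?_⟩
      rw [le_antisymm hx (hmeet ▸ G.min'_le x hxG)]
      exact F.max'_mem hF
    · ext x
      rw [Finset.mem_Ici]
      refine ⟨fun hx => hmeet ▸ G.min'_le x hx, fun hx => (hcover x).elim (fun hxF => ?_) id⟩
      rw [le_antisymm (F.le_max' x hxF) hx, hmeet]
      exact G.min'_mem hG
  all_goals exact absurd h.symm hne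

/-- Cap product formulas in `N_*(cΔ)` for the cone `cΔ = Δ ∗ [v]` on a
euclidean simplex `Δ` (with vertex set `Fin (m+1)`, the cone having vertex set
`Fin (m+2)`):
(a) if `F` is a nonempty face of `Δ` and `G` is the face of `Δ` with `1_F ∪ 1_G = 1_Δ`,
    then `1_{(F,0)} ∩ [cΔ] = (G, 1)`;
(b) `1_{(Δ,1)} ∩ [cΔ] = [v]`;
(c) `1_{(F,1)} ∩ [cΔ] = 0` for every proper face `F` of `Δ`;
(d) for the empty simplex, `1_{(∅,1)} ∩ [c∅] = [v]` (the cone `c∅` being a point). -/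
theorem cone_cap_formulas (m : ℕ) :
    (∀ F G : Finset (Fin (m + 1)), F.Nonempty →
      cupInd R F G = Finsupp.single (Finset.univ : Finset (Fin (m + 1))) 1 →
      capTop R (coneFace F false) = Finsupp.single (coneFace G true) 1) ∧
    (capTop R (coneFace (Finset.univ : Finset (Fin (m + 1))) true)
      = Finsupp.single {Fin.last (m + 1)} 1) ∧
    (∀ F : Finset (Fin (m + 1)), F ≠ Finset.univ →
      capTop R (coneFace F true) = 0) ∧
    (capTop R (coneFace (∅ : Finset (Fin 0)) true) = Finsupp.single {Fin.last 0} 1) := by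
  refine ⟨fun F G _ h => ?_, ?_, fun F hF => ?_, ?_⟩
  · cases subsingleton_or_nontrivial R
    · exact Subsingleton.elim _ _
    · obtain ⟨a, rfl, rfl⟩ := exists_eq_Iic_Ici_of_cupInd_eq R h
      rw [coneFace_Iic_false, coneFace_Ici_true, capTop_Iic]
  · rw [coneFace_true_eq_univ_iff.2 rfl, capTop_univ]
  · exact capTop_eq_zero_of_last_mem R (Finset.mem_insert_self _ _)
      (coneFace_true_eq_univ_iff.not.2 hF)
  · rw [coneFace_true_eq_univ_iff.2 (Subsingleton.elim _ _), capTop_univ]
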